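/- Let 𝓗 = (V, 𝓔) be a hypergraph on n vertices with weight function w : 𝓔 → ℝ≥0. Then there is a universal constant C such that for every ε ∈ (0,1) there exists a weight function w_𝓖 : 𝓔 → ℝ≥0 whose support has at most C·n/ε² hyperedges, such that for every subset S ⊆ V, w*(δ_𝓗(S)) ≤ w_𝓖*(δ_𝓗(S)) ≤ (1+ε)·w*(δ_𝓗(S)). -/

import Mathlib

open Finset

/-- The second notion of cut weight for hypergraphs:
`w*(δ(S)) = Σ_E w_E · |S ∩ E| · |E ∖ S|`. -/
noncomputable def hyperCutWeightStar {n : ℕ} {ℰ : Type} [Fintype ℰ]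
    (edges : ℰ → Finset (Fin n)) (w : ℰ → ℝ) (S : Finset (Fin n)) : ℝ :=
  ∑ e, w e * ((edges e ∩ S).card : ℝ) * (((edges e) \ S).card : ℝ)

namespace Matrix

variable {m : Type*} [Fintype m]

theorem PosSemidef.sq_dotProduct_mulVec_le {M : Matrix m m ℝ} (hM : M.PosSemidef) (x y : m → ℝ) :
    (x ⬝ᵥ M *ᵥ y) ^ 2 ≤ (x ⬝ᵥ M *ᵥ x) * (y ⬝ᵥ M *ᵥ y) := by
  have hsymm : y ⬝ᵥ M *ᵥ x = x ⬝ᵥ M *ᵥ y := by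
    have hT : Mᵀ = M := by simpa using hM.isHermitian.eq
    rw [dotProduct_mulVec, ← mulVec_transpose, hT, dotProduct_comm]
  have h := discrim_le_zero (a := y ⬝ᵥ M *ᵥ y) (b := 2 * (x ⬝ᵥ M *ᵥ y)) (c := x ⬝ᵥ M *ᵥ x) fun s => by
    have := hM.dotProduct_mulVec_nonneg (x + s • y)
    simp only [star_trivial, mulVec_add, mulVec_smul, add_dotProduct, dotProduct_add,
      smul_dotProduct, dotProduct_smul, smul_eq_mul, hsymm] at this
    linarith
  rw [discrim] at h
  nlinarith

theorem PosSemidef.dotProduct_mulVec_le {A B : Matrix m m ℝ} (h : (B - A).PosSemidef) (x : m → ℝ) :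
    x ⬝ᵥ A *ᵥ x ≤ x ⬝ᵥ B *ᵥ x := by
  have := h.dotProduct_mulVec_nonneg x
  simp only [star_trivial, sub_mulVec, dotProduct_sub] at this
  linarith

variable [DecidableEq m]

theorem PosSemidef.trace_mul_nonneg {A B : Matrix m m ℝ} (hA : A.PosSemidef) (hB : B.PosSemidef) :
    0 ≤ (A * B).trace := by
  obtain ⟨W, rfl⟩ : ∃ W : Matrix m m ℝ, A = Wᴴ * W := by
    open scoped MatrixOrder in
    exact CStarAlgebra.nonneg_iff_eq_star_mul_self.mp hA.nonneg
  rw [mul_assoc, trace_mul_comm]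
  exact (hB.mul_mul_conjTranspose_same W).trace_nonneg

theorem PosSemidef.mul_inv_mul_le {N X : Matrix m m ℝ} {c : ℝ} (hN : N.PosDef)
    (hX : X.PosSemidef) (hc : 0 ≤ c) (h : (c • N - X).PosSemidef) :
    (c • X - X * N⁻¹ * X).PosSemidef := by
  have hXT : Xᵀ = X := by simpa using hX.isHermitian.eq
  refine .of_dotProduct_mulVec_nonneg ?_ fun v => ?_
  · refine (IsHermitian.sub (IsSelfAdjoint.smul (.all c) hX.isHermitian) ?_)
    have := isHermitian_conjTranspose_mul_mul X hN.inv.isHermitian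
    rwa [hX.isHermitian.eq] at this
  · have hdet := (isUnit_iff_isUnit_det N).mp hN.isUnit
    set y := N⁻¹ *ᵥ (X *ᵥ v) with hy
    have hNy : N *ᵥ y = X *ᵥ v := by
      rw [hy, mulVec_mulVec, mul_nonsing_inv _ hdet, one_mulVec]
    have h1 : v ⬝ᵥ (X * N⁻¹ * X) *ᵥ v = y ⬝ᵥ X *ᵥ v := by
      rw [mul_assoc, ← mulVec_mulVec, ← mulVec_mulVec, ← hy, dotProduct_mulVec, ← mulVec_transpose,
        hXT, dotProduct_comm]
    have h2 : 0 ≤ y ⬝ᵥ X *ᵥ v := by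
      rw [← hNy]; simpa using hN.posSemidef.dotProduct_mulVec_nonneg y
    have h3 : y ⬝ᵥ X *ᵥ y ≤ c * (y ⬝ᵥ X *ᵥ v) := by
      have := h.dotProduct_mulVec_le y
      rwa [smul_mulVec, hNy, dotProduct_smul, smul_eq_mul] at this
    have h4 : 0 ≤ v ⬝ᵥ X *ᵥ v := by simpa using hX.dotProduct_mulVec_nonneg v
    have h5 := hX.sq_dotProduct_mulVec_le y v
    rw [star_trivial, sub_mulVec, dotProduct_sub, h1, smul_mulVec, dotProduct_smul, smul_eq_mul]
    rcases h2.eq_or_lt with h0 | h0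
    · rw [← h0]; simpa using mul_nonneg hc h4
    · nlinarith

theorem PosSemidef.le_trace_smul {M X : Matrix m m ℝ} (hM : M.PosDef) (hX : X.PosSemidef) :
    ((M⁻¹ * X).trace • M - X).PosSemidef := by
  refine .of_dotProduct_mulVec_nonneg ?_ fun v => ?_
  · exact IsHermitian.sub (IsSelfAdjoint.smul (.all _) hM.isHermitian) hX.isHermitian
  obtain ⟨W, rfl⟩ : ∃ W : Matrix m m ℝ, X = Wᴴ * W := by
    open scoped MatrixOrder in
    exact CStarAlgebra.nonneg_iff_eq_star_mul_self.mp hX.nonneg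
  have hdet := (isUnit_iff_isUnit_det M).mp hM.isUnit
  have hMT : Mᵀ = M := by simpa using hM.isHermitian.eq
  have h1 : v ⬝ᵥ (Wᴴ * W) *ᵥ v = ∑ k, (W k ⬝ᵥ v) ^ 2 := by
    rw [← mulVec_mulVec, dotProduct_mulVec, conjTranspose_eq_transpose_of_trivial, vecMul_transpose]
    simp [dotProduct, mulVec, sq]
  have h2 : (M⁻¹ * (Wᴴ * W)).trace = ∑ k, W k ⬝ᵥ M⁻¹ *ᵥ W k := by
    rw [← mul_assoc, trace_mul_comm, ← mul_assoc]
    simp only [trace, diag, mul_apply, conjTranspose_apply, star_trivial, dotProduct, mulVec,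
      Finset.sum_mul, Finset.mul_sum]
    refine Finset.sum_congr rfl fun k _ => ?_
    rw [Finset.sum_comm]
    simp only [mul_assoc]
  rw [star_trivial, sub_mulVec, dotProduct_sub, h1, smul_mulVec, dotProduct_smul, smul_eq_mul, h2,
    Finset.sum_mul, sub_nonneg]
  refine Finset.sum_le_sum fun k _ => ?_
  have h3 := hM.posSemidef.sq_dotProduct_mulVec_le (M⁻¹ *ᵥ W k) v
  have h4 : M *ᵥ M⁻¹ *ᵥ W k = W k := by rw [mulVec_mulVec, mul_nonsing_inv _ hdet, one_mulVec]
  have h5 : (M⁻¹ *ᵥ W k) ⬝ᵥ M *ᵥ v = W k ⬝ᵥ v := by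
    rw [dotProduct_mulVec, ← mulVec_transpose, hMT, h4]
  rwa [h5, h4, dotProduct_comm (M⁻¹ *ᵥ W k)] at h3

theorem inv_add_smul_eq {M X : Matrix m m ℝ} {s : ℝ} (hM : M.PosDef) (hN : (M + s • X).PosDef) :
    (M + s • X)⁻¹ = M⁻¹ - s • (M⁻¹ * X * M⁻¹) + s ^ 2 • (M⁻¹ * (X * (M + s • X)⁻¹ * X) * M⁻¹) := by
  have hM' := (isUnit_iff_isUnit_det M).mp hM.isUnit
  have hN' := (isUnit_iff_isUnit_det (M + s • X)).mp hN.isUnit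
  set N := M + s • X with hNdef
  have h1 : N⁻¹ = M⁻¹ - s • (M⁻¹ * X * N⁻¹) := by
    have : M⁻¹ * N * N⁻¹ = N⁻¹ + s • (M⁻¹ * X * N⁻¹) := by
      rw [hNdef, mul_add, add_mul, nonsing_inv_mul _ hM', one_mul]; simp
    rw [mul_assoc, mul_nonsing_inv _ hN', mul_one] at this
    exact eq_sub_of_add_eq this.symm
  have h2 : N⁻¹ = M⁻¹ - s • (N⁻¹ * X * M⁻¹) := by
    have : N⁻¹ * N * M⁻¹ = N⁻¹ + s • (N⁻¹ * X * M⁻¹) := by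
      have : N * M⁻¹ = 1 + s • (X * M⁻¹) := by
        rw [hNdef, add_mul, mul_nonsing_inv _ hM', smul_mul_assoc]
      rw [mul_assoc, this, mul_add, mul_one, mul_smul_comm, mul_assoc]
    rw [nonsing_inv_mul _ hN', one_mul] at this
    exact eq_sub_of_add_eq this.symm
  conv_lhs => rw [h1, h2]
  simp only [mul_sub, mul_smul_comm, smul_sub, smul_smul, mul_assoc, sq]
  abel

theorem trace_inv_le_trace_inv_add_smul {M X : Matrix m m ℝ} {s : ℝ} (hM : M.PosDef)
    (hX : X.IsHermitian) (hN : (M + s • X).PosDef) :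
    M⁻¹.trace - s * (M⁻¹ * X * M⁻¹).trace ≤ (M + s • X)⁻¹.trace := by
  have h : (M⁻¹ * (X * (M + s • X)⁻¹ * X) * M⁻¹).PosSemidef := by
    have h1 := hN.inv.posSemidef.conjTranspose_mul_mul_same X
    rw [hX.eq] at h1
    have h2 := h1.conjTranspose_mul_mul_same M⁻¹
    rwa [hM.inv.isHermitian.eq] at h2
  have h' := mul_nonneg (sq_nonneg s) h.trace_nonneg
  rw [inv_add_smul_eq hM hN]
  simp only [trace_add, trace_sub, trace_smul, smul_eq_mul]
  linarith

theorem PosDef.add_smul {M X : Matrix m m ℝ} {s : ℝ} (hM : M.PosDef)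
    (hX : X.PosSemidef) (hs : 0 < 1 + s * (M⁻¹ * X).trace) : (M + s • X).PosDef := by
  rcases le_total 0 s with h | h
  · exact hM.add_posSemidef (hX.smul h)
  · have h1 := (PosSemidef.le_trace_smul hM hX).smul (neg_nonneg.mpr h)
    convert (hM.smul hs).add_posSemidef h1 using 1
    module

theorem trace_inv_add_smul_le {M X : Matrix m m ℝ} {s : ℝ} (hM : M.PosDef)
    (hX : X.PosSemidef) (hs : 0 < 1 + s * (M⁻¹ * X).trace) :
    (M + s • X)⁻¹.trace ≤
      M⁻¹.trace - s * (M⁻¹ * X * M⁻¹).trace / (1 + s * (M⁻¹ * X).trace) := by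
  have hN := hM.add_smul hX hs
  set θ := (M⁻¹ * X).trace with hθ
  have hθ0 : 0 ≤ θ := hM.inv.posSemidef.trace_mul_nonneg hX
  set c := θ / (1 + s * θ) with hc
  have hle : (c • (M + s • X) - X).PosSemidef := by
    have h1 := (PosSemidef.le_trace_smul hM hX).smul (inv_nonneg.mpr hs.le)
    convert h1 using 1
    rw [← hθ]
    have h2 : c * s - 1 = -(1 + s * θ)⁻¹ := by
      rw [hc, div_eq_mul_inv]; linear_combination mul_inv_cancel₀ hs.ne'
    have h3 : c = (1 + s * θ)⁻¹ * θ := by rw [hc]; ring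
    calc c • (M + s • X) - X = c • M + (c * s - 1) • X := by module
      _ = _ := by rw [h2, h3]; module
  have h1 := PosSemidef.mul_inv_mul_le hN hX (by positivity) hle
  have h2 := (h1.conjTranspose_mul_mul_same M⁻¹).trace_nonneg
  rw [hM.inv.isHermitian.eq] at h2
  simp only [mul_sub, sub_mul, trace_sub, mul_smul_comm, smul_mul_assoc, trace_smul,
    smul_eq_mul] at h2
  have h3 := mul_le_mul_of_nonneg_left (sub_nonneg.mp h2) (sq_nonneg s)
  rw [inv_add_smul_eq hM hN]
  simp only [trace_add, trace_sub, trace_smul, smul_eq_mul]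
  have h4 : s * (M⁻¹ * X * M⁻¹).trace / (1 + s * θ)
      = s * (M⁻¹ * X * M⁻¹).trace - s ^ 2 * (c * (M⁻¹ * X * M⁻¹).trace) := by
    rw [hc]; field_simp; ring
  rw [h4]
  linarith

theorem PosDef.mul_self {M : Matrix m m ℝ} (hM : M.PosDef) : (M * M).PosDef := by
  have h := PosDef.conjTranspose_mul_self M (mulVec_injective_iff_isUnit.mpr hM.isUnit)
  rwa [hM.isHermitian.eq] at h

theorem PosSemidef.trace_mul_mul_nonneg {M X : Matrix m m ℝ} (hM : M.PosDef)
    (hX : X.PosSemidef) : 0 ≤ (M⁻¹ * X * M⁻¹).trace := by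
  have h := hX.conjTranspose_mul_mul_same M⁻¹
  rw [hM.inv.isHermitian.eq] at h
  exact h.trace_nonneg

theorem PosDef.trace_inv_mul_inv_le {M : Matrix m m ℝ} (hM : M.PosDef) :
    (M⁻¹ * M⁻¹).trace ≤ M⁻¹.trace ^ 2 := by
  have hdet := (isUnit_iff_isUnit_det M).mp hM.isUnit
  have h := (PosSemidef.le_trace_smul hM PosSemidef.one).trace_mul_nonneg
    hM.inv.mul_self.posSemidef
  rw [sub_mul, smul_mul_assoc, ← mul_assoc, mul_nonsing_inv _ hdet] at h
  simp only [mul_one, one_mul, trace_sub, trace_smul, smul_eq_mul] at h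
  linarith

/-- One step of the barrier method: some `C i` can be added to `A` so that both barriers advance
while neither potential increases. -/
theorem exists_barrier_step [Nonempty m] {ι : Type*} [Fintype ι] {C : ι → Matrix m m ℝ}
    (hC : ∀ i, (C i).PosSemidef) (hsum : ∑ i, C i = 1) {p u l : ℝ} (hp : 0 < p) (hp' : p ≤ 1 / 10)
    {A : Matrix m m ℝ} (hu : (u • 1 - A).PosDef) (hut : (u • 1 - A)⁻¹.trace ≤ p)
    (hl : (A - l • 1).PosDef) (hlt : (A - l • 1)⁻¹.trace ≤ p) :
    ∃ i, ∃ t : ℝ, 0 ≤ t ∧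
      ((u + (1 - 3 * p)⁻¹) • 1 - (A + t • C i)).PosDef ∧
      ((u + (1 - 3 * p)⁻¹) • 1 - (A + t • C i))⁻¹.trace ≤ p ∧
      ((A + t • C i) - (l + 1) • 1).PosDef ∧ ((A + t • C i) - (l + 1) • 1)⁻¹.trace ≤ p := by
  have h3p : 0 < 1 - 3 * p := by linarith
  set δ := (1 - 3 * p)⁻¹ with hδ
  have hδ0 : 0 < δ := by positivity
  obtain ⟨Q, hQ⟩ : ∃ Q, Q = (u + δ) • 1 - A := ⟨_, rfl⟩
  obtain ⟨S, hS⟩ : ∃ S, S = A - (l + 1) • 1 := ⟨_, rfl⟩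
  have hQP : Q + (-δ) • 1 = u • 1 - A := by rw [hQ]; module
  have hSR : S + (1 : ℝ) • 1 = A - l • 1 := by rw [hS]; module
  have hRS : (A - l • 1) + (-1 : ℝ) • 1 = S := by rw [hS]; module
  have hQd : Q.PosDef := by
    have := hu.add_posSemidef (PosSemidef.one.smul hδ0.le)
    convert this using 1
    rw [hQ]; module
  have hRtr : 0 ≤ (A - l • 1)⁻¹.trace := hl.inv.posSemidef.trace_nonneg
  have hpos : 0 < 1 + (-1) * ((A - l • 1)⁻¹ * 1).trace := by rw [mul_one]; linarith
  have hSd : S.PosDef := by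
    rw [← hRS]; exact hl.add_smul PosSemidef.one hpos
  have hStr : S⁻¹.trace ≤ 2 * p := by
    have h1 := trace_inv_add_smul_le hl PosSemidef.one hpos
    have h2 := hl.trace_inv_mul_inv_le
    rw [mul_one, hRS] at h1
    rw [mul_one] at hpos
    have h3 : ((A - l • 1)⁻¹ * (A - l • 1)⁻¹).trace / (1 + -1 * (A - l • 1)⁻¹.trace) ≤ p := by
      rw [div_le_iff₀ hpos]
      nlinarith
    have h4 := neg_div (1 + -1 * (A - l • 1)⁻¹.trace)
      ((A - l • 1)⁻¹ * (A - l • 1)⁻¹).trace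
    rw [neg_one_mul ((A - l • 1)⁻¹ * (A - l • 1)⁻¹).trace, h4] at h1
    linarith
  have hα : 0 < (Q⁻¹ * Q⁻¹).trace := hQd.inv.mul_self.trace_pos
  have hβ : 0 < (S⁻¹ * S⁻¹).trace := hSd.inv.mul_self.trace_pos
  have hQα : Q⁻¹.trace + δ * (Q⁻¹ * Q⁻¹).trace ≤ p := by
    have h := trace_inv_le_trace_inv_add_smul hQd isHermitian_one (hQP ▸ hu)
    rw [hQP, mul_one] at h
    linarith
  have hSβ : S⁻¹.trace - (S⁻¹ * S⁻¹).trace ≤ p := by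
    have h := trace_inv_le_trace_inv_add_smul hSd isHermitian_one (hSR ▸ hl)
    rw [hSR, mul_one] at h
    linarith
  set α := (Q⁻¹ * Q⁻¹).trace
  set β := (S⁻¹ * S⁻¹).trace
  have hsum1 (M : Matrix m m ℝ) : ∑ i, (M * C i).trace = M.trace := by
    rw [← trace_sum, ← Finset.mul_sum, hsum, mul_one]
  have hsum2 (M : Matrix m m ℝ) : ∑ i, (M * C i * M).trace = (M * M).trace := by
    rw [← trace_sum, ← Finset.sum_mul, ← Finset.mul_sum, hsum, mul_one]
  obtain ⟨i, -, hi⟩ : ∃ i ∈ univ, (Q⁻¹ * C i * Q⁻¹).trace / (δ * α) + (Q⁻¹ * C i).trace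
      < (S⁻¹ * C i * S⁻¹).trace / β - (S⁻¹ * C i).trace := by
    apply Finset.exists_lt_of_sum_lt
    rw [Finset.sum_add_distrib, Finset.sum_sub_distrib, ← Finset.sum_div, ← Finset.sum_div,
      hsum1, hsum1, hsum2, hsum2, div_self hβ.ne']
    have : α / (δ * α) = 1 - 3 * p := by
      rw [div_mul_cancel_right₀ hα.ne', hδ, inv_inv]
    rw [this]
    have := mul_pos hδ0 hα
    linarith
  have ha := PosSemidef.trace_mul_mul_nonneg hQd (hC i)
  have hb := hQd.inv.posSemidef.trace_mul_nonneg (hC i)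
  have hb' := hSd.inv.posSemidef.trace_mul_nonneg (hC i)
  have hUp := @trace_inv_add_smul_le m _ _ Q (C i)
  have hLo := @trace_inv_add_smul_le m _ _ S (C i)
  have hUd := @PosDef.add_smul m _ _ Q (C i)
  generalize (Q⁻¹ * C i * Q⁻¹).trace = a at *
  generalize (Q⁻¹ * C i).trace = b at *
  generalize (S⁻¹ * C i * S⁻¹).trace = a' at *
  generalize (S⁻¹ * C i).trace = b' at *
  have hδα := mul_pos hδ0 hα
  have hg : 0 < a' / β - b' := lt_of_le_of_lt (by positivity) hi
  obtain ⟨t, ht⟩ : ∃ t, t = (a' / β - b')⁻¹ := ⟨_, rfl⟩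
  have ht0 : 0 < t := by rw [ht]; positivity
  have hta : t * a < (1 + -t * b) * (δ * α) := by
    have h1 : t * (a / (δ * α) + b) < 1 := by
      rw [ht, inv_mul_lt_iff₀ hg, mul_one]; exact hi
    have h2 : t * a / (δ * α) < 1 + -t * b := by
      rw [mul_add, ← mul_div_assoc] at h1; linarith
    rwa [div_lt_iff₀ hδα] at h2
  have htb : 0 < 1 + -t * b := by
    have : 0 < (1 + -t * b) * (δ * α) := lt_of_le_of_lt (by positivity) hta
    exact (pos_iff_pos_of_mul_pos this).mpr hδα
  have hta' : t * a' = β * (1 + t * b') := by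
    have h1 : t * (a' / β - b') = 1 := by rw [ht]; exact inv_mul_cancel₀ hg.ne'
    field_simp at h1
    linarith
  have htb' : 0 < 1 + t * b' := by positivity
  have e1 : (u + δ) • 1 - (A + t • C i) = Q + (-t) • C i := by rw [hQ]; module
  have e2 : (A + t • C i) - (l + 1) • 1 = S + t • C i := by rw [hS]; module
  refine ⟨i, t, ht0.le, ?_⟩
  rw [e1, e2]
  refine ⟨hUd hQd (hC i) htb, (hUp hQd (hC i) htb).trans ?_,
    hSd.add_posSemidef ((hC i).smul ht0.le), (hLo hSd (hC i) htb').trans ?_⟩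
  · have : t * a / (1 + -t * b) ≤ δ * α := by
      rw [div_le_iff₀ htb]; linarith
    rw [neg_mul t a, neg_div]
    linarith
  · rw [hta', mul_div_cancel_right₀ _ htb'.ne']
    exact hSβ

theorem exists_barrier_iterate [Nonempty m] {ι : Type*} [Fintype ι] [DecidableEq ι]
    {C : ι → Matrix m m ℝ} (hC : ∀ i, (C i).PosSemidef) (hsum : ∑ i, C i = 1) {p : ℝ}
    (hp : 0 < p) (hp' : p ≤ 1 / 10) (T : ℕ) :
    ∃ y : ι → ℝ, (∀ i, 0 ≤ y i) ∧ #{i | y i ≠ 0} ≤ T ∧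
      ((Fintype.card m / p + T * (1 - 3 * p)⁻¹) • 1 - ∑ i, y i • C i).PosDef ∧
      ((Fintype.card m / p + T * (1 - 3 * p)⁻¹) • 1 - ∑ i, y i • C i)⁻¹.trace ≤ p ∧
      (∑ i, y i • C i - (-(Fintype.card m / p) + T) • 1).PosDef ∧
      (∑ i, y i • C i - (-(Fintype.card m / p) + T) • 1)⁻¹.trace ≤ p := by
  induction T with
  | zero =>
    have hn : (0 : ℝ) < Fintype.card m := by exact_mod_cast Fintype.card_pos
    have hd : (((Fintype.card m : ℝ) / p) • (1 : Matrix m m ℝ)).PosDef :=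
      PosDef.one.smul (by positivity)
    have htr : (((Fintype.card m : ℝ) / p) • (1 : Matrix m m ℝ))⁻¹.trace ≤ p := by
      have : (((Fintype.card m : ℝ) / p) • (1 : Matrix m m ℝ))⁻¹
          = (p / Fintype.card m) • (1 : Matrix m m ℝ) := by
        refine inv_eq_left_inv ?_
        rw [smul_mul_smul_comm, mul_one]
        field_simp
        simp
      rw [this, trace_smul, trace_one, smul_eq_mul]
      field_simp
      rfl
    refine ⟨0, by simp, by simp, ?_⟩
    simpa using ⟨hd, htr, hd, htr⟩
  | succ T ih =>
    obtain ⟨y, hy, hcard, h1, h2, h3, h4⟩ := ih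
    obtain ⟨i, t, ht, h⟩ := exists_barrier_step hC hsum hp hp' h1 h2 h3 h4
    refine ⟨y + Pi.single i t, fun j => ?_, ?_, ?_⟩
    · by_cases hj : j = i
      · subst hj; simpa using add_nonneg (hy j) ht
      · simpa [hj] using hy j
    · refine (Finset.card_le_card (t := insert i ({j | y j ≠ 0} : Finset ι)) fun j hj => ?_).trans
        ((Finset.card_insert_le _ _).trans (by lia))
      by_cases hji : j = i
      · simp [hji]
      · simpa [hji] using hj
    · have e : ∑ j, (y + Pi.single i t : ι → ℝ) j • C j = ∑ j, y j • C j + t • C i := by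
        simp [add_smul, Finset.sum_add_distrib, Pi.single_apply]
      rw [e]
      push_cast
      convert h using 4 <;> ring_nf

/-- Sparsification of a decomposition of the identity into positive semidefinite matrices. -/
theorem exists_sparse_approx_one [Nonempty m] {ι : Type*} [Fintype ι] [DecidableEq ι]
    {C : ι → Matrix m m ℝ} (hC : ∀ i, (C i).PosSemidef) (hsum : ∑ i, C i = 1) {ε : ℝ}
    (hε : 0 < ε) (hε' : ε < 1) :
    ∃ y : ι → ℝ, (∀ i, 0 ≤ y i) ∧ (#{i | y i ≠ 0} : ℝ) ≤ 200 * Fintype.card m / ε ^ 2 ∧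
      (∑ i, y i • C i - 1).PosSemidef ∧ ((1 + ε) • 1 - ∑ i, y i • C i).PosSemidef := by
  have hn : (1 : ℝ) ≤ Fintype.card m := by exact_mod_cast Fintype.card_pos
  obtain ⟨p, hp⟩ : ∃ p, p = ε / 10 := ⟨_, rfl⟩
  have hp0 : 0 < p := by rw [hp]; positivity
  have hp1 : p ≤ 1 / 10 := by rw [hp]; linarith
  set N : ℝ := (Fintype.card m : ℝ) with hN
  set T := ⌈N / p ^ 2⌉₊ with hT
  have hT1 : N / p ^ 2 ≤ T := Nat.le_ceil _
  have hT2 : (T : ℝ) ≤ 200 * N / ε ^ 2 := by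
    have h1 := (Nat.ceil_lt_add_one (show 0 ≤ N / p ^ 2 by positivity)).le
    have h2 : 1 ≤ N / p ^ 2 := by
      rw [le_div_iff₀ (by positivity)]; nlinarith
    have h3 : 200 * N / ε ^ 2 = 2 * (N / p ^ 2) := by rw [hp]; field_simp; norm_num
    rw [h3]; linarith
  have hT0 : (0 : ℝ) < T := lt_of_lt_of_le (by positivity) hT1
  have hNT : N / p ≤ p * T := by
    have h1 := mul_le_mul_of_nonneg_left hT1 hp0.le
    have h2 : p * (N / p ^ 2) = N / p := by field_simp
    rwa [h2] at h1
  obtain ⟨y, hy, hcard, h1, -, h2, -⟩ := exists_barrier_iterate hC hsum hp0 hp1 T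
  rw [← hN] at h1 h2
  set l := -(N / p) + (T : ℝ) with hl
  have hl0 : (1 - p) * T ≤ l := by rw [hl]; linarith
  have hlpos : 0 < l := lt_of_lt_of_le (mul_pos (by linarith) hT0) hl0
  have hδ : (1 - 3 * p)⁻¹ ≤ 1 + 5 * p := by
    rw [inv_le_iff_one_le_mul₀ (by linarith)]; nlinarith
  have hu : N / p + T * (1 - 3 * p)⁻¹ ≤ (1 + ε) * l := by
    have hε10 : ε = 10 * p := by rw [hp]; ring
    have h3 := mul_le_mul_of_nonneg_left hδ hT0.le
    have h4 := mul_le_mul_of_nonneg_left hl0 (show 0 ≤ 1 + ε by linarith)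
    have h5 : p + (1 + 5 * p) ≤ (1 + ε) * (1 - p) := by rw [hε10]; nlinarith
    have h6 := mul_le_mul_of_nonneg_right h5 hT0.le
    linarith
  have e : ∑ i, (l⁻¹ * y i) • C i = l⁻¹ • ∑ i, y i • C i := by
    simp only [Finset.smul_sum, smul_smul]
  refine ⟨fun i => l⁻¹ * y i, fun i => mul_nonneg (by positivity) (hy i), ?_, ?_, ?_⟩
  · refine le_trans ?_ hT2
    simpa [hlpos.ne'] using hcard
  · rw [e]
    convert h2.posSemidef.smul (inv_nonneg.mpr hlpos.le) using 1
    rw [smul_sub, smul_smul, inv_mul_cancel₀ hlpos.ne', one_smul]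
  · rw [e]
    have h3 := (h1.posSemidef.add (PosSemidef.one.smul (sub_nonneg.mpr hu))).smul
      (inv_nonneg.mpr hlpos.le)
    convert h3 using 1
    have : (1 + ε) = l⁻¹ * ((1 + ε) * l) := by field_simp
    conv_lhs => rw [this]
    module

/-- A positive semidefinite `L` is congruent, via `S`, to the complement of a positive
semidefinite `E`, and `R` inverts `S` up to the kernel of `L`. -/
theorem PosSemidef.exists_normalization {L : Matrix m m ℝ} (hL : L.PosSemidef) :
    ∃ R S E : Matrix m m ℝ,
      Sᴴ * L * S + E = 1 ∧ E.PosSemidef ∧ E * R = 0 ∧ L * (S * R) = L := by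
  set d := hL.1.eigenvalues with hd
  set U : Matrix m m ℝ := (hL.1.eigenvectorUnitary : Matrix m m ℝ)
  have hU : Uᴴ * U = 1 := Unitary.coe_star_mul_self hL.1.eigenvectorUnitary
  have hLU : L = U * diagonal d * Uᴴ := by
    have := hL.1.spectral_theorem
    rw [Unitary.conjStarAlgAut_apply] at this
    exact this
  have hd0 : ∀ i, 0 ≤ d i := hL.eigenvalues_nonneg
  have hUU (X : Matrix m m ℝ) : Uᴴ * (U * X) = X := by rw [← mul_assoc, hU, one_mul]
  refine ⟨diagonal (fun i => √(d i)) * Uᴴ, U * diagonal (fun i => (√(d i))⁻¹),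
    diagonal (fun i => if d i = 0 then 1 else 0), ?_, ?_, ?_, ?_⟩
  · rw [hLU]
    simp only [conjTranspose_mul, diagonal_conjTranspose, star_trivial, mul_assoc, hUU,
      diagonal_mul_diagonal, diagonal_add]
    rw [← diagonal_one]
    congr 1
    funext i
    by_cases h : d i = 0
    · simp [h]
    · have h1 : √(d i) ≠ 0 := (Real.sqrt_pos.mpr (lt_of_le_of_ne (hd0 i) (Ne.symm h))).ne'
      have h2 := Real.mul_self_sqrt (hd0 i)
      simp only [h, if_false, add_zero]
      nth_rewrite 2 [← h2]
      field_simp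
  · refine PosSemidef.diagonal fun i => ?_
    dsimp only
    split_ifs <;> simp
  · rw [← mul_assoc, diagonal_mul_diagonal]
    have : (fun i => (if d i = 0 then 1 else 0) * √(d i)) = 0 := by
      funext i
      by_cases h : d i = 0 <;> simp [h]
    rw [this]
    simp
  · conv_lhs => rw [hLU]
    conv_rhs => rw [hLU]
    simp only [mul_assoc, hUU]
    simp only [← mul_assoc (diagonal _), diagonal_mul_diagonal]
    congr 3
    funext i
    by_cases h : d i = 0
    · simp [h]
    · have h1 : √(d i) ≠ 0 := (Real.sqrt_pos.mpr (lt_of_le_of_ne (hd0 i) (Ne.symm h))).ne'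
      field_simp

/-- Linear-size spectral sparsification of a sum of positive semidefinite matrices. -/
theorem exists_sparse_approx_sum [Nonempty m] {ι : Type*} [Fintype ι] [DecidableEq ι]
    {B : ι → Matrix m m ℝ} (hB : ∀ i, (B i).PosSemidef) {ε : ℝ} (hε : 0 < ε) (hε' : ε < 1) :
    ∃ y : ι → ℝ, (∀ i, 0 ≤ y i) ∧ (#{i | y i ≠ 0} : ℝ) ≤ 200 * Fintype.card m / ε ^ 2 ∧
      ∀ v : m → ℝ, ∑ i, v ⬝ᵥ B i *ᵥ v ≤ ∑ i, y i * (v ⬝ᵥ B i *ᵥ v) ∧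
        ∑ i, y i * (v ⬝ᵥ B i *ᵥ v) ≤ (1 + ε) * ∑ i, v ⬝ᵥ B i *ᵥ v := by
  obtain ⟨R, S, E, hSE, hE, hER, hLSR⟩ :=
    (posSemidef_sum univ fun i _ => hB i).exists_normalization
  let C : Option ι → Matrix m m ℝ := fun o => o.elim E fun i => Sᴴ * B i * S
  have hC : ∀ o, (C o).PosSemidef := by
    rintro (_ | i)
    · exact hE
    · exact (hB i).conjTranspose_mul_mul_same S
  have hsum : ∑ o, C o = 1 := by
    rw [Fintype.sum_option, ← hSE, Finset.mul_sum, Finset.sum_mul, add_comm]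
    rfl
  obtain ⟨y, hy, hcard, h1, h2⟩ := exists_sparse_approx_one hC hsum hε hε'
  have hker (i : ι) (v : m → ℝ) : B i *ᵥ ((S * R) *ᵥ v) = B i *ᵥ v := by
    rw [← sub_eq_zero, ← mulVec_sub, ← (hB i).dotProduct_mulVec_zero_iff]
    set z := (S * R) *ᵥ v - v
    have hz : (∑ i, B i) *ᵥ z = 0 := by
      rw [mulVec_sub, mulVec_mulVec, hLSR, sub_self]
    have hz' : ∑ i, star z ⬝ᵥ B i *ᵥ z = 0 := by
      rw [← dotProduct_sum, ← sum_mulVec, hz, dotProduct_zero]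
    exact (Finset.sum_eq_zero_iff_of_nonneg
      fun i _ => (hB i).dotProduct_mulVec_nonneg z).mp hz' i (mem_univ i)
  have hquad (i : ι) (v : m → ℝ) : (R *ᵥ v) ⬝ᵥ C (some i) *ᵥ (R *ᵥ v) = v ⬝ᵥ B i *ᵥ v := by
    have hT : (B i)ᵀ = B i := by simpa using (hB i).isHermitian.eq
    have e : C (some i) *ᵥ (R *ᵥ v) = Sᴴ *ᵥ (B i *ᵥ v) := by
      rw [← hker i v]
      simp only [mulVec_mulVec, mul_assoc, C, Option.elim_some]
    rw [e, dotProduct_mulVec, conjTranspose_eq_transpose_of_trivial, vecMul_transpose,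
      mulVec_mulVec, dotProduct_mulVec, ← mulVec_transpose, hT, hker, dotProduct_comm]
  have hnone (v : m → ℝ) : (R *ᵥ v) ⬝ᵥ C none *ᵥ (R *ᵥ v) = 0 := by
    have e : C none *ᵥ (R *ᵥ v) = 0 := by
      simp [mulVec_mulVec, C, hER]
    rw [e, dotProduct_zero]
  have hone (v : m → ℝ) : (R *ᵥ v) ⬝ᵥ (R *ᵥ v) = ∑ i, v ⬝ᵥ B i *ᵥ v := by
    have e : (R *ᵥ v) ⬝ᵥ (R *ᵥ v) = (R *ᵥ v) ⬝ᵥ (∑ o, C o) *ᵥ (R *ᵥ v) := by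
      rw [hsum, one_mulVec]
    rw [e, sum_mulVec, dotProduct_sum, Fintype.sum_option, hnone, zero_add]
    exact Finset.sum_congr rfl fun i _ => hquad i v
  have hsome (v : m → ℝ) : (R *ᵥ v) ⬝ᵥ (∑ o, y o • C o) *ᵥ (R *ᵥ v)
      = ∑ i, y (some i) * (v ⬝ᵥ B i *ᵥ v) := by
    rw [sum_mulVec, dotProduct_sum, Fintype.sum_option]
    simp only [smul_mulVec, dotProduct_smul, hnone, hquad, smul_eq_mul, mul_zero, zero_add]
  refine ⟨fun i => y (some i), fun i => hy _, le_trans ?_ hcard, fun v => ⟨?_, ?_⟩⟩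
  · exact_mod_cast Finset.card_le_card_of_injOn some (fun i hi => by simpa using hi)
      (Option.some_injective ι).injOn
  · have := h1.dotProduct_mulVec_le (R *ᵥ v)
    rwa [one_mulVec, hone, hsome] at this
  · have := h2.dotProduct_mulVec_le (R *ᵥ v)
    rwa [smul_mulVec, one_mulVec, dotProduct_smul, hone, hsome, smul_eq_mul] at this

/-- The Laplacian of the complete graph on `E`. -/
def cliqueLaplacian (E : Finset m) : Matrix m m ℝ :=
  (#E : ℝ) • diagonal (fun i => if i ∈ E then 1 else 0) -
    vecMulVec (fun i => if i ∈ E then 1 else 0) (fun i => if i ∈ E then 1 else 0)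

theorem dotProduct_cliqueLaplacian_mulVec (E : Finset m) (v : m → ℝ) :
    v ⬝ᵥ cliqueLaplacian E *ᵥ v = #E * ∑ i ∈ E, v i ^ 2 - (∑ i ∈ E, v i) ^ 2 := by
  rw [cliqueLaplacian, sub_mulVec, dotProduct_sub, smul_mulVec, dotProduct_smul, smul_eq_mul]
  congr 1
  · simp [dotProduct, mulVec_diagonal, sq]
  · rw [vecMulVec_mulVec, dotProduct_smul]
    simp [dotProduct, sq]

theorem cliqueLaplacian_posSemidef (E : Finset m) : (cliqueLaplacian E).PosSemidef := by
  refine .of_dotProduct_mulVec_nonneg ?_ fun v => ?_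
  · ext i j
    simp [cliqueLaplacian, vecMulVec_apply, diagonal_apply, mul_comm, eq_comm]
    grind
  · rw [star_trivial, dotProduct_cliqueLaplacian_mulVec, sub_nonneg]
    exact sq_sum_le_card_mul_sum_sq

theorem indicator_dotProduct_cliqueLaplacian_mulVec (E S : Finset m) :
    (fun i => if i ∈ S then (1 : ℝ) else 0) ⬝ᵥ
      cliqueLaplacian E *ᵥ (fun i => if i ∈ S then (1 : ℝ) else 0) = #(E ∩ S) * #(E \ S) := by
  rw [dotProduct_cliqueLaplacian_mulVec]
  have h : (#(E ∩ S) : ℝ) + #(E \ S) = #E := by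
    exact_mod_cast Finset.card_inter_add_card_sdiff E S
  simp only [ite_pow, one_pow, ne_eq, OfNat.ofNat_ne_zero, not_false_eq_true, zero_pow,
    Finset.sum_boole, Finset.filter_mem_eq_inter, ← h]
  ring

end Matrix

theorem hyperCutWeightStar_eq_sum_cliqueLaplacian {n : ℕ} {ℰ : Type} [Fintype ℰ]
    (edges : ℰ → Finset (Fin n)) (w : ℰ → ℝ) (S : Finset (Fin n)) :
    hyperCutWeightStar edges w S = ∑ e, w e * ((fun i => if i ∈ S then (1 : ℝ) else 0) ⬝ᵥ
      (Matrix.cliqueLaplacian (edges e)).mulVec (fun i => if i ∈ S then (1 : ℝ) else 0)) := by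
  simp only [hyperCutWeightStar, Matrix.indicator_dotProduct_cliqueLaplacian_mulVec, mul_assoc]

/-- **Cut sparsifiers for hypergraphs (second definition of cut weight).** -/
theorem hypergraph_cut_sparsifier_star :
    ∃ C : ℝ, 0 < C ∧
      ∀ (n : ℕ) (ℰ : Type) (_ : Fintype ℰ) (_ : DecidableEq ℰ)
        (edges : ℰ → Finset (Fin n))
        (w : ℰ → ℝ), (∀ e, 0 ≤ w e) →
        ∀ ε : ℝ, ε ∈ Set.Ioo (0 : ℝ) 1 →
          ∃ wG : ℰ → ℝ,
            (∀ e, 0 ≤ wG e) ∧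
            ((univ.filter fun e => wG e ≠ 0).card : ℝ) ≤ C * n / ε ^ 2 ∧
            ∀ S : Finset (Fin n),
              hyperCutWeightStar edges w S ≤ hyperCutWeightStar edges wG S ∧
              hyperCutWeightStar edges wG S ≤ (1 + ε) * hyperCutWeightStar edges w S := by
  refine ⟨200, by norm_num, fun n ℰ _ _ edges w hw ε hε => ?_⟩
  rcases Nat.eq_zero_or_pos n with rfl | hn
  · have h (E : Finset (Fin 0)) : E = ∅ := Subsingleton.elim _ _
    exact ⟨0, by simp, by simp, fun S => by simp [hyperCutWeightStar, h]⟩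
  have : Nonempty (Fin n) := ⟨⟨0, hn⟩⟩
  obtain ⟨y, hy, hcard, h⟩ := Matrix.exists_sparse_approx_sum
    (B := fun e => w e • Matrix.cliqueLaplacian (edges e))
    (fun e => (Matrix.cliqueLaplacian_posSemidef (edges e)).smul (hw e)) hε.1 hε.2
  rw [Fintype.card_fin] at hcard
  refine ⟨fun e => y e * w e, fun e => mul_nonneg (hy e) (hw e), le_trans ?_ hcard, fun S => ?_⟩
  · exact_mod_cast Finset.card_le_card fun e he => by
      simp only [mem_filter, mem_univ, true_and] at he ⊢
      exact left_ne_zero_of_mul he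
  · have hS := h fun i => if i ∈ S then 1 else 0
    simp only [Matrix.smul_mulVec, dotProduct_smul, smul_eq_mul, ← mul_assoc] at hS
    simpa only [hyperCutWeightStar_eq_sum_cliqueLaplacian] using hS
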